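/- arXiv:1808.01800 — 4 statements merged into one kernel-verified Lean document; each statement's English description precedes it below -/
import Mathlib

section
/- Let w be a k-uniform word over an alphabet V and let A be a nonempty subset of {1,...,k}. Then the word p_A(w) is (#A)-uniform, and for any two distinct letters x, y in V, if the word obtained from w by deleting all letters other than x and y equals (xy)^k, then the word obtained from p_A(w) by deleting all letters other than x and y equals (xy)^{#A}. -/
open SimpleGraph

variable {V V' : Type*}

/-- Two letters `x` and `y` alternate in the word `w` if the word obtained from `w` by
deleting all letters other than `x` and `y` has no two consecutive equal letters. -/
def alternate [DecidableEq V] (w : List V) (x y : V) : Prop :=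
  (w.filter (fun z => decide (z = x ∨ z = y))).Chain' (· ≠ ·)

/-- A word `w` over the alphabet `V` represents the graph `G`: every letter of the
alphabet occurs in `w`, and two distinct letters alternate in `w` iff they are
adjacent in `G`. -/
def represents [DecidableEq V] (G : SimpleGraph V) (w : List V) : Prop :=
  (∀ x : V, x ∈ w) ∧ ∀ x y : V, x ≠ y → (alternate w x y ↔ G.Adj x y)

/-- A word is `k`-uniform if every letter of the alphabet occurs exactly `k` times. -/
def uniform [DecidableEq V] (k : ℕ) (w : List V) : Prop :=
  ∀ x : V, w.count x = k

/-- Label each letter with its occurrence number (`1`-based): the `i`th occurrence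
of the letter `x` in `w` becomes the pair `(x, i)`. -/
def labelAux [DecidableEq V] (c : V → ℕ) : List V → List (V × ℕ)
  | [] => []
  | x :: xs => (x, c x + 1) :: labelAux (Function.update c x (c x + 1)) xs

/-- The labelled version of a word. -/
def label [DecidableEq V] (w : List V) : List (V × ℕ) := labelAux (fun _ => 0) w

/-- `pA A w` keeps, for each letter `x`, exactly the `i`th occurrences of `x` for
`i ∈ A`, and deletes all other occurrences. -/
def pA [DecidableEq V] (A : Finset ℕ) (w : List V) : List V :=
  ((label w).filter (fun p => decide (p.2 ∈ A))).map Prod.fst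

/-- Applying an occurrence-based function `h` to a word `w`: the `i`th occurrence of a
letter `x` in `w` is replaced by the string `h x i`. -/
def obf [DecidableEq V] (h : V → ℕ → List V') (w : List V) : List V' :=
  (label w).flatMap (fun p => h p.1 p.2)

/-- `(xy)^n`. -/
def altWord (x y : V) (n : ℕ) : List V := (List.replicate n [x, y]).flatten

theorem Finset.card_Ioc_inter_succ (A : Finset ℕ) (m n : ℕ) :
    (Finset.Ioc m (m + (n + 1)) ∩ A).card =
      (if m + 1 ∈ A then 1 else 0) + (Finset.Ioc (m + 1) (m + 1 + n) ∩ A).card := by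
  have h : Finset.Ioc m (m + (n + 1)) = insert (m + 1) (Finset.Ioc (m + 1) (m + 1 + n)) := by
    ext i
    simp only [Finset.mem_Ioc, Finset.mem_insert]
    omega
  rw [h]
  split_ifs with hm
  · rw [Finset.insert_inter_of_mem hm, Finset.card_insert_of_notMem (by simp), add_comm]
  · rw [Finset.insert_inter_of_notMem hm, zero_add]

theorem labelAux_congr {V : Type*} [DecidableEq V] (w : List V) {c d : V → ℕ}
    (h : ∀ x ∈ w, c x = d x) : labelAux c w = labelAux d w := by
  induction w generalizing c d with
  | nil => rfl
  | cons x xs ih =>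
    have hx : c x = d x := h x (by simp)
    simp only [labelAux, hx]
    congr 1
    apply ih
    intro z hz
    by_cases hzx : z = x
    · simp [hzx]
    · simp [hzx, h z (by simp [hz])]

theorem filter_labelAux {V : Type*} [DecidableEq V] (P : V → Bool) (w : List V) (c : V → ℕ) :
    (labelAux c w).filter (fun p => P p.1) = labelAux c (w.filter P) := by
  induction w generalizing c with
  | nil => rfl
  | cons x xs ih =>
    by_cases hx : P x
    · simp [labelAux, hx, ih]
    · simp only [labelAux, hx, List.filter_cons, ih]
      apply labelAux_congr
      intro z hz
      have hzx : z ≠ x := by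
        rintro rfl
        exact hx (List.mem_filter.mp hz).2
      simp [hzx]

theorem filter_pA {V : Type*} [DecidableEq V] (P : V → Bool) (A : Finset ℕ) (w : List V) :
    (pA A w).filter P = pA A (w.filter P) := by
  simp only [pA, label, ← filter_labelAux, List.filter_map, List.filter_filter,
    Function.comp_def, Bool.and_comm]

theorem count_filter_labelAux {V : Type*} [DecidableEq V] (A : Finset ℕ) (x : V) (w : List V)
    (c : V → ℕ) :
    (((labelAux c w).filter (fun p => decide (p.2 ∈ A))).map Prod.fst).count x =
      (Finset.Ioc (c x) (c x + w.count x) ∩ A).card := by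
  induction w generalizing c with
  | nil => simp [labelAux]
  | cons z zs ih =>
    by_cases hz : z = x
    · subst hz
      rw [List.count_cons_self, Finset.card_Ioc_inter_succ]
      have := ih (Function.update c z (c z + 1))
      rw [Function.update_self] at this
      rw [← this]
      by_cases hA : c z + 1 ∈ A <;> simp [labelAux, hA, add_comm]
    · have := ih (Function.update c z (c z + 1))
      rw [Function.update_of_ne (Ne.symm hz)] at this
      rw [List.count_cons_of_ne hz, ← this]
      by_cases hA : c z + 1 ∈ A <;> simp [labelAux, hA, hz]

theorem altWord_succ {V : Type*} (x y : V) (n : ℕ) :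
    altWord x y (n + 1) = x :: y :: altWord x y n := by
  simp [altWord, List.replicate_succ]

theorem map_filter_labelAux_altWord {V : Type*} [DecidableEq V] (A : Finset ℕ) {x y : V}
    (hxy : x ≠ y) (n m : ℕ) (c : V → ℕ) (hx : c x = m) (hy : c y = m) :
    ((labelAux c (altWord x y n)).filter (fun p => decide (p.2 ∈ A))).map Prod.fst =
      altWord x y (Finset.Ioc m (m + n) ∩ A).card := by
  induction n generalizing m c with
  | zero => simp [altWord, labelAux]
  | succ n ih =>
    have := ih (m + 1)
      (Function.update (Function.update c x (m + 1)) y (m + 1)) (by simp [hxy]) (by simp)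
    rw [Finset.card_Ioc_inter_succ, altWord_succ]
    by_cases hA : m + 1 ∈ A
    · simp [labelAux, hA, hx, hy, hxy.symm, this, add_comm 1, altWord_succ]
    · simp [labelAux, hA, hx, hy, hxy.symm, this]

theorem stmt0 {V : Type*} [DecidableEq V] (k : ℕ) (w : List V) (hw : uniform k w)
    (A : Finset ℕ) (hA : A.Nonempty) (hAk : A ⊆ Finset.Icc 1 k) :
    uniform A.card (pA A w) ∧
      ∀ x y : V, x ≠ y →
        w.filter (fun z => decide (z = x ∨ z = y)) = altWord x y k →
        (pA A w).filter (fun z => decide (z = x ∨ z = y)) = altWord x y A.card := by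
  have hI : Finset.Ioc 0 (0 + k) ∩ A = A := by
    rw [Finset.inter_eq_right, zero_add]
    exact hAk
  refine ⟨fun x => ?_, fun x y hxy h => ?_⟩
  · rw [pA, label, count_filter_labelAux, hw x, hI]
  · rw [filter_pA, h, pA, label, map_filter_labelAux_altWord A hxy k 0 _ rfl rfl, hI]
end

section
/- Let w be a k-uniform word representing a graph G. For some m > 1, let A_1, ..., A_m be nonempty subsets of {1,...,k} such that for every j with 1 ≤ j ≤ k−1 there exists i ∈ {1,...,m} with {j, j+1} ⊆ A_i. Then the concatenation w' = p_{A_1}(w) p_{A_2}(w) ⋯ p_{A_m}(w) is a (Σ_{i=1}^m #A_i)-uniform word that also represents the graph G. -/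
open SimpleGraph

variable {V V' : Type*}

/-- Every prefix of `w` contains as many letters `x` as letters `y`, or exactly one more:
the occurrences of `x` and `y` alternate in `w`, and those of `x` come first. -/
def AlternatesFrom [DecidableEq V] (x y : V) (w : List V) : Prop :=
  ∀ v, v <+: w → v.count y ≤ v.count x ∧ v.count x ≤ v.count y + 1

section AlternatesFrom

variable [DecidableEq V] {x y z : V} {w : List V}

lemma alternatesFrom_nil : AlternatesFrom x y [] := by
  intro v hv
  simp [List.prefix_nil.1 hv]

lemma alternatesFrom_cons_first (hxy : x ≠ y) :
    AlternatesFrom x y (x :: w) ↔ AlternatesFrom y x w := by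
  constructor
  · intro h v hv
    have := h (x :: v) ((List.prefix_cons_inj x).2 hv)
    simp [hxy] at this
    omega
  · intro h v hv
    rcases List.prefix_cons_iff.1 hv with rfl | ⟨t, rfl, ht⟩
    · simp
    · have := h t ht
      simp [hxy]
      omega

lemma not_alternatesFrom_cons_second (hxy : x ≠ y) : ¬ AlternatesFrom x y (y :: w) := by
  intro h
  have := h [y] (by simp)
  simp [hxy.symm] at this

lemma alternatesFrom_cons_other (hx : z ≠ x) (hy : z ≠ y) :
    AlternatesFrom x y (z :: w) ↔ AlternatesFrom x y w := by
  constructor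
  · intro h v hv
    have := h (z :: v) ((List.prefix_cons_inj z).2 hv)
    simpa [List.count_cons, hx, hy] using this
  · intro h v hv
    rcases List.prefix_cons_iff.1 hv with rfl | ⟨t, rfl, ht⟩
    · simp
    · simpa [List.count_cons, hx, hy] using h t ht

lemma isChain_cons_filter_iff_alternatesFrom (hxy : x ≠ y) :
    (x :: w.filter (fun z => decide (z = x ∨ z = y))).IsChain (· ≠ ·) ↔
      AlternatesFrom y x w := by
  induction w generalizing x y with
  | nil => simp [alternatesFrom_nil]
  | cons z w ih =>
    by_cases hzx : z = x
    · subst hzx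
      simp [not_alternatesFrom_cons_second hxy.symm]
    by_cases hzy : z = y
    · subst hzy
      rw [alternatesFrom_cons_first hxy.symm, ← ih hxy.symm]
      simp [hxy, or_comm]
    · rw [alternatesFrom_cons_other hzy hzx, ← ih hxy]
      simp [hzx, hzy]

lemma alternate_iff_alternatesFrom (hxy : x ≠ y) :
    alternate w x y ↔ AlternatesFrom x y w ∨ AlternatesFrom y x w := by
  change (w.filter _).IsChain (· ≠ ·) ↔ _
  induction w with
  | nil => simp [alternatesFrom_nil]
  | cons z w ih =>
    by_cases hzx : z = x
    · subst hzx
      rw [alternatesFrom_cons_first hxy, ← isChain_cons_filter_iff_alternatesFrom hxy]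
      simp [not_alternatesFrom_cons_second hxy.symm]
    by_cases hzy : z = y
    · subst hzy
      rw [alternatesFrom_cons_first hxy.symm,
        ← isChain_cons_filter_iff_alternatesFrom (w := w) hxy.symm]
      simp [not_alternatesFrom_cons_second hxy, or_comm]
    · rw [alternatesFrom_cons_other hzx hzy, alternatesFrom_cons_other hzy hzx, ← ih]
      simp [hzx, hzy]

lemma alternatesFrom_append {u v : List V} (hu : u.count x = u.count y) :
    AlternatesFrom x y (u ++ v) ↔ AlternatesFrom x y u ∧ AlternatesFrom x y v := by
  constructor
  · intro h
    refine ⟨fun t ht => h t (ht.trans (List.prefix_append u v)), fun t ht => ?_⟩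
    have := h (u ++ t) ((List.prefix_append_right_inj u).2 ht)
    simp only [List.count_append] at this
    omega
  · rintro ⟨h₁, h₂⟩ t ht
    rcases List.prefix_or_prefix_of_prefix ht (List.prefix_append u v) with h | ⟨s, rfl⟩
    · exact h₁ t h
    · have := h₂ s ((List.prefix_append_right_inj u).1 ht)
      simp only [List.count_append]
      omega

lemma alternatesFrom_flatten {L : List (List V)} (hL : ∀ l ∈ L, l.count x = l.count y) :
    AlternatesFrom x y L.flatten ↔ ∀ l ∈ L, AlternatesFrom x y l := by
  induction L with
  | nil => simp [alternatesFrom_nil]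
  | cons l L ih =>
    rw [List.flatten_cons, alternatesFrom_append (hL l (by simp)),
      ih fun l' hl' => hL l' (by simp [hl'])]
    simp

end AlternatesFrom

section Projection

variable [DecidableEq V]

lemma prefix_labelAux_iff (c : V → ℕ) (w : List V) (l : List (V × ℕ)) :
    l <+: labelAux c w ↔ ∃ v, v <+: w ∧ l = labelAux c v := by
  induction w generalizing c l with
  | nil =>
    simp only [labelAux, List.prefix_nil]
    constructor
    · rintro rfl
      exact ⟨[], rfl, rfl⟩
    · rintro ⟨v, rfl, rfl⟩
      rfl
  | cons a w ih =>
    simp only [labelAux, List.prefix_cons_iff, ih]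
    constructor
    · rintro (rfl | ⟨t, rfl, v, hv, rfl⟩)
      · exact ⟨[], Or.inl rfl, rfl⟩
      · exact ⟨a :: v, Or.inr ⟨v, rfl, hv⟩, rfl⟩
    · rintro ⟨v, rfl | ⟨t, rfl, ht⟩, rfl⟩
      · exact Or.inl rfl
      · exact Or.inr ⟨_, rfl, t, ht, rfl⟩

lemma prefix_pA_iff (A : Finset ℕ) (w t : List V) :
    t <+: pA A w ↔ ∃ v, v <+: w ∧ t = pA A v := by
  simp only [pA, label, List.prefix_map_iff, List.prefix_filter_iff, prefix_labelAux_iff]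
  constructor
  · rintro ⟨_, ⟨_, ⟨v, hv, rfl⟩, rfl⟩, rfl⟩
    exact ⟨v, hv, rfl⟩
  · rintro ⟨v, hv, rfl⟩
    exact ⟨_, ⟨_, ⟨v, hv, rfl⟩, rfl⟩, rfl⟩

lemma count_map_filter_labelAux (A : Finset ℕ) (c : V → ℕ) (w : List V) (x : V) :
    (((labelAux c w).filter (fun p => decide (p.2 ∈ A))).map Prod.fst).count x =
      (A ∩ Finset.Ioc (c x) (c x + w.count x)).card := by
  induction w generalizing c with
  | nil => simp [labelAux]
  | cons a w ih =>
    have h := ih (Function.update c a (c a + 1))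
    by_cases hax : a = x
    · subst hax
      have hI : Finset.Ioc (c a) (c a + (w.count a + 1)) =
          insert (c a + 1) (Finset.Ioc (c a + 1) (c a + 1 + w.count a)) := by
        ext j
        simp only [Finset.mem_Ioc, Finset.mem_insert]
        omega
      rw [Function.update_self] at h
      rw [List.count_cons_self, hI]
      by_cases hA : c a + 1 ∈ A
      · rw [Finset.inter_insert_of_mem hA, Finset.card_insert_of_notMem (by simp), ← h]
        simp [labelAux, hA]
      · rw [Finset.inter_insert_of_notMem hA, ← h]
        simp [labelAux, hA]
    · rw [Function.update_of_ne (Ne.symm hax)] at h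
      rw [List.count_cons_of_ne hax, ← h]
      by_cases hA : c a + 1 ∈ A <;> simp [labelAux, hA, hax]

lemma count_pA (A : Finset ℕ) (w : List V) (x : V) :
    (pA A w).count x = (A ∩ Finset.Ioc 0 (w.count x)).card := by
  simpa [pA, label] using count_map_filter_labelAux A (fun _ => 0) w x

lemma uniform.projection {k : ℕ} {w : List V} (hw : uniform k w) {A : Finset ℕ}
    (hA : A ⊆ Finset.Icc 1 k) : uniform A.card (pA A w) := by
  intro x
  rw [count_pA, hw x, Finset.inter_eq_left.2]
  exact hA

lemma AlternatesFrom.projection {x y : V} {w : List V} (h : AlternatesFrom x y w) (A : Finset ℕ) :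
    AlternatesFrom x y (pA A w) := by
  intro t ht
  obtain ⟨v, hv, rfl⟩ := (prefix_pA_iff A w t).1 ht
  obtain ⟨h₁, h₂⟩ := h v hv
  rw [count_pA, count_pA]
  constructor
  · gcongr
  · calc (A ∩ Finset.Ioc 0 (v.count x)).card
        ≤ (insert (v.count y + 1) (A ∩ Finset.Ioc 0 (v.count y))).card := by
          apply Finset.card_le_card
          intro j
          simp only [Finset.mem_insert, Finset.mem_inter, Finset.mem_Ioc]
          intro hj
          have : j = v.count y + 1 ∨ j ≤ v.count y := by omega
          tauto
      _ ≤ _ := Finset.card_insert_le _ _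

/-- If the sets `A i` cover `{1, …, k}` and every pair of consecutive elements of it lies in
some `A i`, then alternation can be tested on the projections `pA (A i) w`. -/
lemma AlternatesFrom.of_projection {ι : Type*} {k : ℕ} {w : List V} (hw : uniform k w)
    {A : ι → Finset ℕ} (hmem : ∀ j, 1 ≤ j → j ≤ k → ∃ i, j ∈ A i)
    (hcov : ∀ j, 1 ≤ j → j ≤ k - 1 → ∃ i, j ∈ A i ∧ j + 1 ∈ A i) {x y : V}
    (h : ∀ i, AlternatesFrom x y (pA (A i) w)) : AlternatesFrom x y w := by
  intro v hv
  have hx : v.count x ≤ k := hw x ▸ hv.sublist.count_le x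
  have hy : v.count y ≤ k := hw y ▸ hv.sublist.count_le y
  have hp i := h i _ ((prefix_pA_iff (A i) w _).2 ⟨v, hv, rfl⟩)
  simp only [count_pA] at hp
  constructor
  · by_contra! hlt
    obtain ⟨i, hi⟩ := hmem (v.count x + 1) (by omega) (by omega)
    have hle : (insert (v.count x + 1) (A i ∩ Finset.Ioc 0 (v.count x))).card ≤
        (A i ∩ Finset.Ioc 0 (v.count y)).card := by
      apply Finset.card_le_card
      intro j
      simp only [Finset.mem_insert, Finset.mem_inter, Finset.mem_Ioc]
      rintro (rfl | hj)
      · exact ⟨hi, by omega⟩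
      · exact ⟨hj.1, by omega⟩
    rw [Finset.card_insert_of_notMem (by simp)] at hle
    have := (hp i).1
    omega
  · by_contra! hlt
    obtain ⟨i, hi, hi'⟩ := hcov (v.count y + 1) (by omega) (by omega)
    have hle : (insert (v.count y + 1 + 1)
        (insert (v.count y + 1) (A i ∩ Finset.Ioc 0 (v.count y)))).card ≤
        (A i ∩ Finset.Ioc 0 (v.count x)).card := by
      apply Finset.card_le_card
      intro j
      simp only [Finset.mem_insert, Finset.mem_inter, Finset.mem_Ioc]
      rintro (rfl | rfl | hj)
      · exact ⟨hi', by omega⟩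
      · exact ⟨hi, by omega⟩
      · exact ⟨hj.1, by omega⟩
    rw [Finset.card_insert_of_notMem (by simp), Finset.card_insert_of_notMem (by simp)] at hle
    have := (hp i).2
    omega

end Projection

theorem stmt1 {V : Type*} [DecidableEq V] (G : SimpleGraph V) (k : ℕ) (w : List V)
    (hw : uniform k w) (hrep : represents G w) (m : ℕ) (hm : 1 < m)
    (A : Fin m → Finset ℕ) (hne : ∀ i, (A i).Nonempty)
    (hsub : ∀ i, A i ⊆ Finset.Icc 1 k)
    (hcov : ∀ j, 1 ≤ j → j ≤ k - 1 → ∃ i, j ∈ A i ∧ j + 1 ∈ A i) :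
    uniform (∑ i, (A i).card) (List.ofFn (fun i => pA (A i) w)).flatten ∧
      represents G (List.ofFn (fun i => pA (A i) w)).flatten := by
  have hunif i := hw.projection (hsub i)
  have hmem : ∀ j, 1 ≤ j → j ≤ k → ∃ i, j ∈ A i := by
    intro j hj hjk
    by_cases hlt : j ≤ k - 1
    · exact (hcov j hj hlt).imp fun _ h => h.1
    by_cases hj1 : j = 1
    · obtain ⟨a, ha⟩ := hne ⟨0, by omega⟩
      have := Finset.mem_Icc.1 (hsub _ ha)
      exact ⟨_, (show a = j by omega) ▸ ha⟩
    · obtain ⟨i, -, hi⟩ := hcov (j - 1) (by omega) (by omega)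
      exact ⟨i, by rwa [Nat.sub_add_cancel hj] at hi⟩
  have hflat (x y : V) : AlternatesFrom x y (List.ofFn (fun i => pA (A i) w)).flatten ↔
      AlternatesFrom x y w := by
    rw [alternatesFrom_flatten (by simp [hunif _ _]),
      List.forall_mem_ofFn_iff]
    exact ⟨AlternatesFrom.of_projection hw hmem hcov, fun h i => h.projection (A i)⟩
  refine ⟨fun x => ?_, fun x => ?_, fun x y hxy => ?_⟩
  · rw [List.count_flatten, List.map_ofFn, List.sum_ofFn]
    exact Finset.sum_congr rfl fun i _ => hunif i x
  · have hx : x ∈ pA (A ⟨0, by omega⟩) w :=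
      List.count_pos_iff.1 (by rw [hunif _ x]; exact (hne _).card_pos)
    exact List.mem_flatten.2 ⟨_, List.mem_ofFn.2 ⟨_, rfl⟩, hx⟩
  · rw [← hrep.2 x y hxy, alternate_iff_alternatesFrom hxy, alternate_iff_alternatesFrom hxy,
      hflat, hflat]
end

section
/- Let G be a graph with vertex set V, let k > 1, and let w be a k-uniform word representing G. Let f and g be the occurrence-based functions defined by f(x,1) = x_1, f(x,i) = x_2 x_1 for 1 < i ≤ k, and g(x,1) = x_2, g(x,2) = x_1 x_2, g(x,i) = ε for 2 < i ≤ k. Then the word w' = f(w) g(w), over the alphabet {x_1, x_2 : x ∈ V}, is a (k+1)-uniform word representing the Cartesian product G □ K_2, where x_1 denotes the vertex (x, 1) and x_2 the vertex (x, 2) of G □ K_2. -/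
open SimpleGraph

variable {V V' : Type*}

/-- The occurrence-based function `f`: `f(x,1) = x₁` and `f(x,i) = x₂x₁` for `i > 1`,
where `x₁ = (x,0)` and `x₂ = (x,1)` are the two copies of `x` in `G □ K₂`. -/
def fTwo (x : V) (i : ℕ) : List (V × Fin 2) :=
  if i = 1 then [(x, 0)] else [(x, 1), (x, 0)]

/-- The occurrence-based function `g`: `g(x,1) = x₂`, `g(x,2) = x₁x₂`, and
`g(x,i) = ε` for `i > 2`. -/
def gTwo (x : V) (i : ℕ) : List (V × Fin 2) :=
  if i = 1 then [(x, 1)] else if i = 2 then [(x, 0), (x, 1)] else []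

section PrefixBalanced

variable {α : Type*} [BEq α]

/-- The word `l` contains at least as many `a`s as `b`s, and at most one more. -/
def CountBalanced (a b : α) (l : List α) : Prop :=
  l.count b ≤ l.count a ∧ l.count a ≤ l.count b + 1

/-- Every prefix of `l` is balanced, i.e. `a` and `b` alternate in `l`, starting with `a`. -/
def PrefixBalanced (a b : α) (l : List α) : Prop :=
  ∀ p, p <+: l → CountBalanced a b p

theorem prefixBalanced_nil (a b : α) : PrefixBalanced a b [] := by
  intro p hp
  simp [List.prefix_nil.1 hp, CountBalanced]

theorem prefixBalanced_append {a b : α} {u v : List α} :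
    PrefixBalanced a b (u ++ v) ↔
      PrefixBalanced a b u ∧ ∀ r, r <+: v → CountBalanced a b (u ++ r) := by
  constructor
  · intro h
    exact ⟨fun p hp => h p (hp.trans (List.prefix_append u v)),
      fun r hr => h _ ((List.prefix_append_right_inj u).2 hr)⟩
  · rintro ⟨hu, hv⟩ p hp
    rcases le_total p.length u.length with hl | hl
    · exact hu p (List.prefix_of_prefix_length_le hp (List.prefix_append u v) hl)
    · obtain ⟨r, rfl⟩ := List.prefix_of_prefix_length_le (List.prefix_append u v) hp hl
      exact hv r ((List.prefix_append_right_inj u).1 hp)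

theorem balanced_append_prefix {a b : α} {u v r : List α}
    (hv : v.count a + v.count b ≤ 1) (hr : r <+: v) (hu : CountBalanced a b u)
    (huv : CountBalanced a b (u ++ v)) : CountBalanced a b (u ++ r) := by
  have ha := hr.sublist.count_le a
  have hb := hr.sublist.count_le b
  simp only [CountBalanced, List.count_append] at *
  omega

variable [LawfulBEq α]

theorem prefixBalanced_cons_left {a b : α} (hab : a ≠ b) (l : List α) :
    PrefixBalanced a b (a :: l) ↔ PrefixBalanced b a l := by
  have := prefixBalanced_append (a := a) (b := b) (u := [a]) (v := l)
  rw [List.singleton_append] at this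
  rw [this]
  constructor
  · intro h p hp
    have := h.2 p hp
    simp only [CountBalanced, List.singleton_append, List.count_cons_self,
      List.count_cons_of_ne hab] at this ⊢
    omega
  · intro h
    have key : ∀ r, r <+: l → CountBalanced a b ([a] ++ r) := by
      intro p hp
      have := h p hp
      simp only [CountBalanced, List.singleton_append, List.count_cons_self,
        List.count_cons_of_ne hab] at this ⊢
      omega
    refine ⟨fun p hp => ?_, key⟩
    rcases List.prefix_cons_iff.1 hp with rfl | ⟨t, rfl, ht⟩
    · simp [CountBalanced]
    · simpa [List.prefix_nil.1 ht] using key [] (List.nil_prefix)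

theorem not_prefixBalanced_cons_right {a b : α} (hab : a ≠ b) (l : List α) :
    ¬ PrefixBalanced a b (b :: l) := by
  intro h
  have := h [b] (by simp)
  simp [CountBalanced, hab.symm] at this

theorem prefixBalanced_cons_of_ne {a b c : α} (hca : c ≠ a) (hcb : c ≠ b) (l : List α) :
    PrefixBalanced a b (c :: l) ↔ PrefixBalanced a b l := by
  constructor
  · intro h p hp
    simpa [CountBalanced, hca, hcb] using h (c :: p) (by simpa using hp)
  · intro h p hp
    rcases List.prefix_cons_iff.1 hp with rfl | ⟨t, rfl, ht⟩
    · simp [CountBalanced]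
    · simpa [CountBalanced, hca, hcb] using h t ht

end PrefixBalanced

section Alternate

variable {α : Type*} [DecidableEq α]

theorem alternate_iff_isChain (l : List α) (a b : α) :
    alternate l a b ↔ (l.filter (fun z => decide (z = a ∨ z = b))).IsChain (· ≠ ·) :=
  Iff.rfl

theorem alternate_comm (l : List α) (a b : α) : alternate l a b ↔ alternate l b a := by
  simp only [alternate_iff_isChain, or_comm]

variable [BEq α] [LawfulBEq α]

theorem prefixBalanced_iff_alternate {a b : α} (hab : a ≠ b) (l : List α) :
    PrefixBalanced a b l ↔ alternate l a b ∧
      (l.filter (fun z => decide (z = a ∨ z = b))).head? ≠ some b := by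
  induction l generalizing a b with
  | nil => simp [prefixBalanced_nil, alternate_iff_isChain]
  | cons c l ih =>
    by_cases hca : c = a
    · subst hca
      rw [prefixBalanced_cons_left hab, ih hab.symm, alternate_comm]
      simp only [alternate_iff_isChain, List.filter_cons, or_comm (b := _ = c)]
      simp [List.isChain_cons, hab]
      rw [and_comm, and_congr_left_iff]
      intro _
      constructor
      · rintro h y hy rfl
        exact h hy
      · exact fun h hy => h _ hy rfl
    · by_cases hcb : c = b
      · subst hcb
        simp [not_prefixBalanced_cons_right hab]
      · rw [prefixBalanced_cons_of_ne hca hcb, ih hab]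
        simp [alternate_iff_isChain, hca, hcb]

theorem alternate_iff_prefixBalanced {a b : α} (hab : a ≠ b) (l : List α) :
    alternate l a b ↔ PrefixBalanced a b l ∨ PrefixBalanced b a l := by
  rw [prefixBalanced_iff_alternate hab, prefixBalanced_iff_alternate hab.symm, alternate_comm l b a]
  simp only [or_comm (b := _ = a), ← and_or_left]
  refine ⟨fun h => ⟨h, ?_⟩, fun h => h.1⟩
  by_contra! h
  exact hab (Option.some_injective _ (h.2.symm.trans h.1))

end Alternate

section OccurrenceBased

variable {α β : Type*} [DecidableEq α]

theorem mem_of_uniform {k : ℕ} (hk : 0 < k) {w : List α} (hw : uniform k w) (x : α) : x ∈ w :=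
  List.count_pos_iff.1 (by rwa [hw x])

theorem labelAux_concat (c : α → ℕ) (w : List α) (z : α) :
    labelAux c (w ++ [z]) = labelAux c w ++ [(z, c z + w.count z + 1)] := by
  induction w generalizing c with
  | nil => simp [labelAux]
  | cons x w ih =>
    simp only [List.cons_append, labelAux, ih, List.count_cons, Function.update_apply]
    by_cases h : z = x
    · subst h
      simp
      omega
    · simp [h, Ne.symm h]

theorem obf_concat (h : α → ℕ → List β) (w : List α) (z : α) :
    obf h (w ++ [z]) = obf h w ++ h z (w.count z + 1) := by
  simp [obf, label, labelAux_concat]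

theorem obf_nil (h : α → ℕ → List β) : obf h [] = [] := rfl

/-- If every block contains at most one of the letters `a`, `b`, then balancedness only needs
to be tested at the ends of blocks. -/
theorem prefixBalanced_append_obf [BEq β] [LawfulBEq β] {a b : β} {h : α → ℕ → List β}
    (hh : ∀ z i, (h z i).count a + (h z i).count b ≤ 1) (u : List β) (w : List α) :
    PrefixBalanced a b (u ++ obf h w) ↔
      PrefixBalanced a b u ∧ ∀ p, p <+: w → CountBalanced a b (u ++ obf h p) := by
  induction w using List.reverseRecOn with
  | nil =>
    simp only [obf_nil, List.append_nil, List.prefix_nil, forall_eq]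
    exact ⟨fun H => ⟨H, H u (List.prefix_refl u)⟩, fun H => H.1⟩
  | append_singleton w z ih =>
    rw [obf_concat, ← List.append_assoc, prefixBalanced_append, ih]
    simp only [List.prefix_concat_iff]
    constructor
    · rintro ⟨⟨h1, h2⟩, h3⟩
      refine ⟨h1, ?_⟩
      rintro p (rfl | hp)
      · rw [obf_concat, ← List.append_assoc]
        exact h3 _ (List.prefix_refl _)
      · exact h2 p hp
    · rintro ⟨h1, h2⟩
      refine ⟨⟨h1, fun p hp => h2 p (Or.inr hp)⟩, fun r hr => ?_⟩
      have h3 := h2 _ (Or.inl rfl)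
      rw [obf_concat, ← List.append_assoc] at h3
      exact balanced_append_prefix (hh _ _) hr (h2 w (Or.inr (List.prefix_refl w))) h3

theorem exists_prefix_concat_count (w : List α) (y : α) (n : ℕ) (hn : n < w.count y) :
    ∃ p, p ++ [y] <+: w ∧ p.count y = n := by
  induction w using List.reverseRecOn with
  | nil => simp at hn
  | append_singleton w z ih =>
    by_cases h : n < w.count y
    · obtain ⟨p, hp, hc⟩ := ih h
      exact ⟨p, hp.trans (List.prefix_append _ _), hc⟩
    · rw [List.count_append, List.count_singleton] at hn
      by_cases hz : z = y
      · subst hz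
        refine ⟨w, List.prefix_refl _, ?_⟩
        simp at hn
        omega
      · simp [hz] at hn
        omega

end OccurrenceBased

section CopyCounts

variable {V : Type*} [DecidableEq V] [BEq (V × Fin 2)] [LawfulBEq (V × Fin 2)]

theorem count_fTwo_zero (x z : V) (i : ℕ) :
    (fTwo z i).count (x, 0) = if z = x then 1 else 0 := by
  unfold fTwo
  split_ifs <;> simp_all

theorem count_fTwo_one (x z : V) (i : ℕ) :
    (fTwo z i).count (x, 1) = if z = x ∧ i ≠ 1 then 1 else 0 := by
  unfold fTwo
  split_ifs <;> simp_all

theorem count_gTwo_zero (x z : V) (i : ℕ) :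
    (gTwo z i).count (x, 0) = if z = x ∧ i = 2 then 1 else 0 := by
  unfold gTwo
  split_ifs <;> simp_all

theorem count_gTwo_one (x z : V) (i : ℕ) :
    (gTwo z i).count (x, 1) = if z = x ∧ (i = 1 ∨ i = 2) then 1 else 0 := by
  unfold gTwo
  split_ifs <;> simp_all

theorem count_obf_fTwo_zero (x : V) (w : List V) :
    (obf fTwo w).count (x, 0) = w.count x := by
  induction w using List.reverseRecOn with
  | nil => rfl
  | append_singleton w z ih =>
    simp [obf_concat, ih, count_fTwo_zero, List.count_singleton]

theorem count_obf_fTwo_one (x : V) (w : List V) :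
    (obf fTwo w).count (x, 1) = w.count x - 1 := by
  induction w using List.reverseRecOn with
  | nil => rfl
  | append_singleton w z ih =>
    simp only [obf_concat, List.count_append, ih, count_fTwo_one, List.count_singleton, beq_iff_eq]
    by_cases hz : z = x
    · subst hz
      by_cases h0 : w.count z = 0
      · simp [h0]
      · simp [h0]
        omega
    · simp [hz]

theorem count_obf_gTwo_zero (x : V) (w : List V) :
    (obf gTwo w).count (x, 0) = min (w.count x - 1) 1 := by
  induction w using List.reverseRecOn with
  | nil => rfl
  | append_singleton w z ih =>
    simp only [obf_concat, List.count_append, ih, count_gTwo_zero, List.count_singleton, beq_iff_eq]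
    by_cases hz : z = x
    · subst hz
      simp only [true_and, if_true]
      split_ifs <;> omega
    · simp [hz]

theorem count_obf_gTwo_one (x : V) (w : List V) :
    (obf gTwo w).count (x, 1) = min (w.count x) 2 := by
  induction w using List.reverseRecOn with
  | nil => rfl
  | append_singleton w z ih =>
    simp only [obf_concat, List.count_append, ih, count_gTwo_one, List.count_singleton, beq_iff_eq]
    by_cases hz : z = x
    · subst hz
      simp only [true_and, if_true]
      split_ifs <;> omega
    · simp [hz]

theorem count_fTwo_le (x z : V) (a : Fin 2) (i : ℕ) :
    (fTwo z i).count (x, a) ≤ if z = x then 1 else 0 := by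
  fin_cases a
  · exact (count_fTwo_zero x z i).le
  · have := count_fTwo_one x z i
    simp only [Fin.mk_one, Fin.isValue, this]
    split_ifs <;> simp_all

theorem count_gTwo_le (x z : V) (a : Fin 2) (i : ℕ) :
    (gTwo z i).count (x, a) ≤ if z = x then 1 else 0 := by
  fin_cases a
  · have := count_gTwo_zero x z i
    simp only [Fin.zero_eta, Fin.isValue, this]
    split_ifs <;> simp_all
  · have := count_gTwo_one x z i
    simp only [Fin.mk_one, Fin.isValue, this]
    split_ifs <;> simp_all

end CopyCounts

section CartesianProduct

variable {V : Type*} [DecidableEq V]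

theorem uniform_obf_fTwo_append_gTwo {w : List V} {k : ℕ} (hk : 1 < k) (hw : uniform k w) :
    uniform (k + 1) (obf fTwo w ++ obf gTwo w) := by
  rintro ⟨x, a⟩
  fin_cases a <;>
  · simp only [Fin.zero_eta, Fin.mk_one, List.count_append, count_obf_fTwo_zero,
      count_obf_fTwo_one, count_obf_gTwo_zero, count_obf_gTwo_one, hw x]
    omega

/-- For letters over distinct vertices, balancedness of `f(w)g(w)` only needs to be tested on
images of prefixes of `w`. -/
theorem prefixBalanced_obf_fTwo_append_gTwo {x y : V} (hxy : x ≠ y) (a b : Fin 2) (w : List V) :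
    PrefixBalanced (x, a) (y, b) (obf fTwo w ++ obf gTwo w) ↔
      ∀ p, p <+: w → CountBalanced (x, a) (y, b) (obf fTwo p) ∧
        CountBalanced (x, a) (y, b) (obf fTwo w ++ obf gTwo p) := by
  have hf : ∀ z i, (fTwo z i).count (x, a) + (fTwo z i).count (y, b) ≤ 1 := by
    intro z i
    have h1 := count_fTwo_le x z a i
    have h2 := count_fTwo_le y z b i
    split_ifs at h1 h2 <;> first | omega | (subst_vars; exact absurd rfl hxy)
  have hg : ∀ z i, (gTwo z i).count (x, a) + (gTwo z i).count (y, b) ≤ 1 := by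
    intro z i
    have h1 := count_gTwo_le x z a i
    have h2 := count_gTwo_le y z b i
    split_ifs at h1 h2 <;> first | omega | (subst_vars; exact absurd rfl hxy)
  have hf' := prefixBalanced_append_obf hf [] w
  simp only [List.nil_append, prefixBalanced_nil, true_and] at hf'
  rw [prefixBalanced_append_obf hg, hf']
  simp only [← forall_and]

theorem prefixBalanced_same_copy {x y : V} (hxy : x ≠ y) (a : Fin 2) {w : List V} {k : ℕ}
    (hk : 1 < k) (hw : uniform k w) :
    PrefixBalanced (x, a) (y, a) (obf fTwo w ++ obf gTwo w) ↔ PrefixBalanced x y w := by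
  rw [prefixBalanced_obf_fTwo_append_gTwo hxy]
  refine forall₂_congr fun p _ => ?_
  fin_cases a <;>
  · simp only [Fin.zero_eta, Fin.mk_one, CountBalanced, List.count_append, count_obf_fTwo_zero,
      count_obf_fTwo_one, count_obf_gTwo_zero, count_obf_gTwo_one, hw x, hw y]
    omega

theorem not_alternate_distinct_copies {x y : V} (hxy : x ≠ y) {w : List V} {k : ℕ}
    (hk : 1 < k) (hw : uniform k w) :
    ¬ alternate (obf fTwo w ++ obf gTwo w) (x, 0) (y, 1) := by
  rw [alternate_iff_prefixBalanced (by simp), prefixBalanced_obf_fTwo_append_gTwo hxy,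
    prefixBalanced_obf_fTwo_append_gTwo hxy.symm]
  simp only [CountBalanced, List.count_append, count_obf_fTwo_zero,
      count_obf_fTwo_one, count_obf_gTwo_zero, count_obf_gTwo_one, hw x, hw y]
  rintro (h | h)
  · obtain ⟨p, hp, hc⟩ := exists_prefix_concat_count w y 1 (by rw [hw y]; exact hk)
    have h1 := h p ((List.prefix_append _ _).trans hp)
    have h2 := h _ hp
    simp only [List.count_append, List.count_singleton_self, List.count_singleton, beq_iff_eq,
      hxy.symm, if_false] at h2
    omega
  · have := h w (List.prefix_refl w)
    rw [hw x, hw y] at this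
    omega

theorem prefixBalanced_obf_fTwo_self (x : V) (w : List V) :
    PrefixBalanced (x, 0) (x, 1) (obf fTwo w) := by
  induction w using List.reverseRecOn with
  | nil => exact prefixBalanced_nil _ _
  | append_singleton w z ih =>
    rw [obf_concat, prefixBalanced_append]
    refine ⟨ih, fun r hr => ?_⟩
    have h0 := hr.sublist.count_le (x, 0)
    have h1 := hr.sublist.count_le (x, 1)
    rw [count_fTwo_zero] at h0
    rw [count_fTwo_one] at h1
    simp only [CountBalanced, List.count_append, count_obf_fTwo_zero, count_obf_fTwo_one]
    by_cases hz : z = x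
    · subst hz
      unfold fTwo at hr
      split_ifs at hr with hi
      · simp only [hi] at h0 h1
        simp at h0 h1
        omega
      · simp only [List.prefix_cons_iff, List.prefix_nil] at hr
        rcases hr with rfl | ⟨t, rfl, rfl | ⟨t, rfl, rfl⟩⟩ <;> simp [-List.count_pos_iff] <;> omega
    · simp only [hz, false_and, if_false] at h0 h1
      omega

theorem prefixBalanced_obf_self (x : V) {w : List V} {k : ℕ} (hk : 1 < k) (hw : uniform k w) :
    PrefixBalanced (x, 0) (x, 1) (obf fTwo w ++ obf gTwo w) := by
  suffices ∀ v : List V, PrefixBalanced (x, 0) (x, 1) (obf fTwo w ++ obf gTwo v) from this w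
  intro v
  induction v using List.reverseRecOn with
  | nil => simpa [obf_nil] using prefixBalanced_obf_fTwo_self x w
  | append_singleton v z ih =>
    rw [obf_concat, ← List.append_assoc, prefixBalanced_append]
    refine ⟨ih, fun r hr => ?_⟩
    have h0 := hr.sublist.count_le (x, 0)
    have h1 := hr.sublist.count_le (x, 1)
    rw [count_gTwo_zero] at h0
    rw [count_gTwo_one] at h1
    simp only [CountBalanced, List.count_append, count_obf_fTwo_zero, count_obf_fTwo_one,
      count_obf_gTwo_zero, count_obf_gTwo_one, hw x]
    by_cases hz : z = x
    · subst hz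
      unfold gTwo at hr
      split_ifs at hr with hi hi' <;> simp only [List.prefix_cons_iff, List.prefix_nil] at hr
      · rcases hr with rfl | ⟨t, rfl, rfl⟩ <;> simp <;> omega
      · rcases hr with rfl | ⟨t, rfl, rfl | ⟨t, rfl, rfl⟩⟩ <;> simp <;> omega
      · subst hr
        simp
        omega
    · simp only [hz, false_and, if_false] at h0 h1
      omega

end CartesianProduct

theorem stmt3 {V : Type*} [DecidableEq V] (G : SimpleGraph V) (k : ℕ) (hk : 1 < k)
    (w : List V) (hw : uniform k w) (hrep : represents G w) :
    uniform (k + 1) (obf fTwo w ++ obf gTwo w) ∧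
      represents (G □ (⊤ : SimpleGraph (Fin 2))) (obf fTwo w ++ obf gTwo w) := by
  have hu := uniform_obf_fTwo_append_gTwo hk hw
  refine ⟨hu, mem_of_uniform k.succ_pos hu, ?_⟩
  rintro ⟨x, a⟩ ⟨y, b⟩ hne
  rw [boxProd_adj]
  by_cases hxy : x = y
  · subst hxy
    have hab : a ≠ b := fun h => hne (by rw [h])
    have halt : alternate (obf fTwo w ++ obf gTwo w) (x, 0) (x, 1) :=
      (alternate_iff_prefixBalanced (by simp) _).2 (Or.inl (prefixBalanced_obf_self x hk hw))
    have halt' := (alternate_comm _ _ _).1 halt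
    fin_cases a <;> fin_cases b <;> simp_all
  · by_cases hab : a = b
    · subst hab
      rw [alternate_iff_prefixBalanced hne, prefixBalanced_same_copy hxy a hk hw,
        prefixBalanced_same_copy (Ne.symm hxy) a hk hw, ← alternate_iff_prefixBalanced hxy,
        hrep.2 x y hxy]
      simp
    · have h1 := not_alternate_distinct_copies hxy hk hw
      have h2 := not_alternate_distinct_copies (Ne.symm hxy) hk hw
      rw [alternate_comm] at h2
      fin_cases a <;> fin_cases b <;> simp_all
end

section
/- For every n ≥ 3, the prism graph, i.e., the Cartesian product C_n □ K_2 of the cycle graph C_n on n vertices with the complete graph K_2, is 3-representable. -/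
open SimpleGraph

variable {V V' : Type*}

/-- Two triples of positions interlace, the first one starting. -/
def interlace (a b : Fin 3 → ℕ) : Prop :=
  a 0 < b 0 ∧ b 0 < a 1 ∧ a 1 < b 1 ∧ b 1 < a 2 ∧ a 2 < b 2

/-- Listing the letters in the order of their positions gives a `3`-uniform word in which
two letters alternate iff their triples of positions interlace. -/
theorem exists_word_of_positions {V : Type*} [Fintype V] [DecidableEq V] (p : V → Fin 3 → ℕ)
    (hinj : Function.Injective fun e : V × Fin 3 => p e.1 e.2)
    (h01 : ∀ v, p v 0 < p v 1) (h12 : ∀ v, p v 1 < p v 2) :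
    ∃ w : List V, uniform 3 w ∧ ∀ x y, x ≠ y →
      (alternate w x y ↔ interlace (p x) (p y) ∨ interlace (p y) (p x)) := by
  let r : V × Fin 3 → V × Fin 3 → Prop := fun a b => p a.1 a.2 ≤ p b.1 b.2
  have : DecidableRel r := fun a b => inferInstanceAs (Decidable (p a.1 a.2 ≤ p b.1 b.2))
  have : Std.Total r := ⟨fun a b => le_total _ _⟩
  have : IsTrans (V × Fin 3) r := ⟨fun a b c => le_trans⟩
  have : Std.Antisymm r := ⟨fun a b h h' => hinj (le_antisymm h h')⟩
  let L := (Finset.univ : Finset (V × Fin 3)).toList.insertionSort r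
  have hperm : L.Perm (Finset.univ : Finset (V × Fin 3)).toList := List.perm_insertionSort r _
  have hnodup : L.Nodup := hperm.nodup_iff.2 (Finset.nodup_toList _)
  have hmem : ∀ e, e ∈ L := fun e => hperm.mem_iff.2 (by simp)
  have hsorted : L.Pairwise r := List.pairwise_insertionSort r _
  refine ⟨L.map Prod.fst, fun x => ?_, fun x y hxy => ?_⟩
  · have : (L.filter fun e => e.1 == x).Perm [(x, 0), (x, 1), (x, 2)] := by
      rw [List.perm_ext_iff_of_nodup (hnodup.filter _) (by simp)]
      rintro ⟨v, i⟩
      fin_cases i <;> simp [hmem]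
    rw [List.count, List.countP_map, List.countP_eq_length_filter]
    exact this.length_eq
  · have hp : (L.filter fun e => decide (e.1 = x ∨ e.1 = y)).Perm
        [(x, 0), (x, 1), (x, 2), (y, 0), (y, 1), (y, 2)] := by
      rw [List.perm_ext_iff_of_nodup (hnodup.filter _) (by simp [hxy])]
      rintro ⟨v, i⟩
      fin_cases i <;> simp [hmem]
    have heq := List.Perm.eq_of_pairwise' (hsorted.filter _)
      (List.pairwise_insertionSort r _) (hp.trans (List.perm_insertionSort r _).symm)
    have hne : ∀ i j, p x i ≠ p y j := fun i j h =>
      hxy (congrArg Prod.fst (@hinj (x, i) (y, j) h))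
    have hw : (L.map Prod.fst).filter (fun z => decide (z = x ∨ z = y)) =
        (L.filter fun e => decide (e.1 = x ∨ e.1 = y)).map Prod.fst := by
      rw [List.filter_map]; rfl
    rw [alternate, hw, heq]
    have := h01 x
    have := h12 x
    have := h01 y
    have := h12 y
    have := hne 0 0
    have := hne 0 1
    have := hne 0 2
    have := hne 1 0
    have := hne 1 1
    have := hne 1 2
    have := hne 2 0
    have := hne 2 1
    have := hne 2 2
    have hyx := hxy.symm
    have := (h01 y).le
    have := (h12 y).le
    simp only [List.insertionSort_cons, List.insertionSort_nil, List.orderedInsert_nil,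
      List.orderedInsert_cons, List.Chain', r, interlace, if_true, *]
    split_ifs <;> simp only [List.orderedInsert_cons, List.orderedInsert_nil] <;>
      split_ifs <;> (try omega) <;> simp only [List.orderedInsert_cons, List.orderedInsert_nil] <;>
      split_ifs <;> (try omega) <;> simp [hxy, hyx] <;> omega

theorem uniform.mem {V : Type*} [DecidableEq V] {w : List V} (hw : uniform 3 w) (x : V) :
    x ∈ w :=
  List.count_pos_iff.1 (by rw [hw x]; norm_num)

/-- The positions of the three occurrences of each vertex of the prism, a rotationally symmetric
pattern on a circle of length `6 * n` cut open at `0`. -/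
def prismPos (n : ℕ) (v : Fin n × Fin 2) : Fin 3 → ℕ :=
  let i := v.1.val
  if v.2 = 0 then
    if i + 1 = n then ![1, 8, 6 * i]
    else if i + 2 = n then ![2, 6 * i, 6 * i + 7]
    else ![6 * i, 6 * i + 7, 6 * i + 14]
  else
    if i + 1 = n then ![5, 15, 6 * i + 4]
    else if i + 2 = n then ![9, 6 * i + 4, 6 * i + 11]
    else if i + 3 = n then ![3, 6 * i + 4, 6 * i + 11]
    else ![6 * i + 4, 6 * i + 11, 6 * i + 21]

theorem cycleGraph_adj_iff_val {n : ℕ} (hn : 3 ≤ n) (i j : Fin n) :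
    (cycleGraph n).Adj i j ↔ i.val + 1 = j.val ∨ j.val + 1 = i.val ∨
      (i.val = 0 ∧ j.val + 1 = n) ∨ (j.val = 0 ∧ i.val + 1 = n) := by
  rw [cycleGraph_adj']
  rcases lt_trichotomy i j with h | rfl | h
  · rw [Fin.coe_sub_iff_lt.2 h, Fin.coe_sub_iff_le.2 h.le]
    omega
  · have : NeZero n := ⟨by omega⟩
    have h0 : (i - i).val = 0 := by simp
    omega
  · rw [Fin.coe_sub_iff_lt.2 h, Fin.coe_sub_iff_le.2 h.le]
    omega

theorem prismPos_injective {n : ℕ} (hn : 5 ≤ n) :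
    Function.Injective fun e : (Fin n × Fin 2) × Fin 3 => prismPos n e.1 e.2 := by
  rintro ⟨⟨⟨i, hi⟩, s⟩, k⟩ ⟨⟨⟨j, hj⟩, t⟩, l⟩ h
  have : i = j ∧ s = t ∧ k = l := by
    revert h
    dsimp only [prismPos]
    fin_cases s <;> fin_cases t <;> simp <;> split_ifs <;> fin_cases k <;> fin_cases l <;>
      simp <;> omega
  simpa [and_assoc] using this

theorem prism_adj_iff_interlace {n : ℕ} (hn : 5 ≤ n) (x y : Fin n × Fin 2) (hxy : x ≠ y) :
    (interlace (prismPos n x) (prismPos n y) ∨ interlace (prismPos n y) (prismPos n x)) ↔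
      (cycleGraph n □ (⊤ : SimpleGraph (Fin 2))).Adj x y := by
  rw [boxProd_adj, cycleGraph_adj_iff_val (by omega)]
  obtain ⟨⟨i, hi⟩, s⟩ := x
  obtain ⟨⟨j, hj⟩, t⟩ := y
  revert hxy
  dsimp only [prismPos, interlace]
  fin_cases s <;> fin_cases t <;> simp <;> split_ifs <;> simp <;> omega

theorem represents_prism_three : ∃ w : List (Fin 3 × Fin 2), uniform 3 w ∧
    represents (cycleGraph 3 □ (⊤ : SimpleGraph (Fin 2))) w := by
  refine ⟨[(0, 0), (1, 1), (2, 1), (1, 0), (2, 0), (0, 1), (1, 1), (0, 0), (1, 0), (2, 1),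
    (0, 1), (1, 1), (2, 0), (2, 1), (0, 0), (0, 1), (1, 0), (2, 0)], ?_, ?_⟩
  · unfold uniform
    decide
  · simp only [represents, alternate, List.Chain', boxProd_adj, cycleGraph_adj', top_adj]
    decide +kernel

theorem represents_prism_four : ∃ w : List (Fin 4 × Fin 2), uniform 3 w ∧
    represents (cycleGraph 4 □ (⊤ : SimpleGraph (Fin 2))) w := by
  refine ⟨[(0, 0), (2, 1), (3, 1), (2, 0), (3, 0), (1, 1), (2, 1), (1, 0), (2, 0), (0, 1),
    (1, 1), (0, 0), (1, 0), (3, 1), (2, 1), (3, 0), (0, 1), (3, 1), (1, 1), (2, 0), (0, 0),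
    (0, 1), (3, 0), (1, 0)], ?_, ?_⟩
  · unfold uniform
    decide
  · simp only [represents, alternate, List.Chain', boxProd_adj, cycleGraph_adj', top_adj]
    decide +kernel

theorem stmt7 (n : ℕ) (hn : 3 ≤ n) :
    ∃ w : List (Fin n × Fin 2), uniform 3 w ∧
      represents (cycleGraph n □ (⊤ : SimpleGraph (Fin 2))) w := by
  obtain rfl | rfl | h5 : n = 3 ∨ n = 4 ∨ 5 ≤ n := by omega
  · exact represents_prism_three
  · exact represents_prism_four
  · obtain ⟨w, hu, hw⟩ := exists_word_of_positions (prismPos n) (prismPos_injective h5)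
      (fun ⟨i, s⟩ => by
        dsimp only [prismPos]
        split_ifs <;> simp <;> omega)
      (fun ⟨i, s⟩ => by
        dsimp only [prismPos]
        split_ifs <;> simp <;> omega)
    refine ⟨w, hu, fun x => ?_, fun x y hxy => ?_⟩
    · exact hu.mem x
    · rw [hw x y hxy, prism_adj_iff_interlace h5 x y hxy]
end
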